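/- Suppose G ⊆ Sym ℝ[X̄]^{t×t} and M_G is archimedean. For symmetric f, f(x) ⪰ 0 for all x ∈ S_G if and only if f + εI ∈ M_G for every real ε > 0. -/

import Mathlib

open Matrix

variable (n t : ℕ)

/-- Membership in the quadratic module `M_G` generated by `G` in `ℝ[X̄]^{t×t}`. -/
def InQM (G : Set (Matrix (Fin t) (Fin t) (MvPolynomial (Fin n) ℝ)))
    (f : Matrix (Fin t) (Fin t) (MvPolynomial (Fin n) ℝ)) : Prop :=
  ∃ (N : ℕ) (g p : Fin N → Matrix (Fin t) (Fin t) (MvPolynomial (Fin n) ℝ)),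
    (∀ i, g i = 1 ∨ g i ∈ G) ∧ f = ∑ i, (p i)ᵀ * g i * p i

/-- The positivity set `S_G ⊆ ℝⁿ`. -/
def SG (G : Set (Matrix (Fin t) (Fin t) (MvPolynomial (Fin n) ℝ))) :
    Set (Fin n → ℝ) :=
  {x | ∀ g ∈ G, (g.map (MvPolynomial.eval x)).PosSemidef}

/-- `M_G` is archimedean. -/
def IsArch (G : Set (Matrix (Fin t) (Fin t) (MvPolynomial (Fin n) ℝ))) : Prop :=
  ∀ a : Matrix (Fin t) (Fin t) (MvPolynomial (Fin n) ℝ),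
    ∃ N : ℕ, InQM n t G ((N : Matrix (Fin t) (Fin t) (MvPolynomial (Fin n) ℝ)) - aᵀ * a)

section OrderUnit

variable {E : Type*} [AddCommGroup E] [Module ℝ E]

/-- The states of the cone `C` with order unit `e`, as functions on the ambient space. -/
def stateSpace (C : PointedCone ℝ E) (e : E) : Set (E → ℝ) :=
  {L | ∃ l : E →ₗ[ℝ] ℝ, ⇑l = L ∧ (∀ x ∈ C, 0 ≤ l x) ∧ l e = 1}

lemma exists_state_nonpos (C : PointedCone ℝ E) {e : E} (he : e ∈ C)
    (hu : ∀ x, ∃ c : ℝ, c • e - x ∈ C) {y : E} (hy : y ∉ C) :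
    ∃ l : E →ₗ[ℝ] ℝ, (∀ x ∈ C, 0 ≤ l x) ∧ l e = 1 ∧ l y ≤ 0 := by
  have hneg : ∀ c : ℝ, c < 0 → c • e ∉ C := by
    intro c hc hce
    obtain ⟨d, hd⟩ := hu (-y)
    have hmem : d • e ∈ C := by
      rcases le_total 0 d with h | h
      · exact C.smul_mem h he
      · have := C.smul_mem (div_nonneg_of_nonpos h hc.le) hce
        rwa [smul_smul, div_mul_cancel₀ _ hc.ne] at this
    have hmem' : (-d) • e ∈ C := by
      rcases le_total d 0 with h | h
      · exact C.smul_mem (neg_nonneg.2 h) he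
      · have := C.smul_mem (div_nonneg_of_nonpos (neg_nonpos.2 h) hc.le) hce
        rwa [smul_smul, div_mul_cancel₀ _ hc.ne] at this
    apply hy
    have := C.add_mem hd hmem'
    rwa [neg_smul, sub_neg_eq_add, add_comm, neg_add_cancel_left] at this
  have he0 : e ≠ 0 := fun h => hneg (-1) (by norm_num) (by simp [h])
  let D : PointedCone ℝ E := C ⊔ Submodule.span _ {-y}
  have hCD : C ≤ D := le_sup_left
  have hD : ∀ c : ℝ, c • e ∈ D → 0 ≤ c := by
    intro c hc
    by_contra! hlt
    obtain ⟨z, hz, w, hw, hzw⟩ := Submodule.mem_sup.1 hc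
    obtain ⟨⟨b, hb⟩, rfl⟩ := Submodule.mem_span_singleton.1 hw
    replace hzw : z + b • (-y) = c • e := hzw
    rcases hb.eq_or_lt with rfl | hb
    · rw [zero_smul, add_zero] at hzw
      exact hneg c hlt (hzw ▸ hz)
    · apply hy
      have h1 := C.smul_mem (inv_nonneg.2 hb.le)
        (C.add_mem hz (C.smul_mem (neg_nonneg.2 hlt.le) he))
      rwa [show z + (-c) • e = b • y by rw [neg_smul, ← hzw]; module, smul_smul,
        inv_mul_cancel₀ hb.ne', one_smul] at h1
  obtain ⟨l, hl, hlD⟩ := riesz_extension D (LinearPMap.mkSpanSingleton (K := ℝ) (L := ℝ)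
    (σ := RingHom.id ℝ) e (1 : ℝ) he0)
    (by
      rintro ⟨x, hx⟩ hxD
      obtain ⟨c, rfl⟩ := Submodule.mem_span_singleton.1 hx
      exact (hD c hxD).trans_eq <|
        ((LinearPMap.mkSpanSingleton'_apply (σ := RingHom.id ℝ) e (1 : ℝ) _ c hx).trans
          (mul_one c)).symm)
    (by
      intro x
      obtain ⟨c, hc⟩ := hu (-x)
      refine ⟨⟨c • e, Submodule.mem_span_singleton.2 ⟨c, rfl⟩⟩, hCD ?_⟩
      simpa using hc)
  refine ⟨l, fun x hx => hlD x (hCD hx), ?_, ?_⟩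
  · have := hl ⟨e, Submodule.mem_span_singleton_self e⟩
    rwa [LinearPMap.mkSpanSingleton_apply] at this
  · have := hlD (-y) ((le_sup_right : _ ≤ D) (Submodule.mem_span_singleton_self _))
    rw [map_neg] at this
    linarith

lemma convex_stateSpace (C : PointedCone ℝ E) (e : E) : Convex ℝ (stateSpace C e) := by
  rintro _ ⟨l, rfl, hl, hle⟩ _ ⟨m, rfl, hm, hme⟩ a b ha hb hab
  refine ⟨a • l + b • m, rfl, fun x hx => ?_, by simp [hle, hme, hab]⟩
  have := mul_nonneg ha (hl x hx)
  have := mul_nonneg hb (hm x hx)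
  simp only [LinearMap.add_apply, LinearMap.smul_apply, smul_eq_mul]
  linarith

lemma stateSpace_eq (C : PointedCone ℝ E) (e : E) :
    stateSpace C e = {L | (∀ x y, L (x + y) = L x + L y) ∧ (∀ (c : ℝ) x, L (c • x) = c * L x) ∧
      (∀ x ∈ C, 0 ≤ L x) ∧ L e = 1} := by
  ext L
  constructor
  · rintro ⟨l, rfl, hl, hle⟩
    exact ⟨map_add l, map_smul l, hl, hle⟩
  · rintro ⟨h1, h2, h3, h4⟩
    exact ⟨⟨⟨L, h1⟩, h2⟩, rfl, h3, h4⟩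

lemma isCompact_stateSpace (C : PointedCone ℝ E) {e : E}
    (hu : ∀ x, ∃ c : ℝ, c • e - x ∈ C) : IsCompact (stateSpace C e) := by
  choose c hc using hu
  refine (isCompact_univ_pi fun x : E => isCompact_Icc (a := -c (-x)) (b := c x)).of_isClosed_subset
    ?_ ?_
  · rw [stateSpace_eq]
    refine IsClosed.and ?_ (IsClosed.and ?_ (IsClosed.and ?_ ?_))
    · simp only [Set.ofPred_forall]
      exact isClosed_iInter fun x => isClosed_iInter fun y =>
        isClosed_eq (by fun_prop) (by fun_prop)
    · simp only [Set.ofPred_forall]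
      exact isClosed_iInter fun a => isClosed_iInter fun x =>
        isClosed_eq (by fun_prop) (by fun_prop)
    · simp only [Set.ofPred_forall]
      exact isClosed_iInter fun x => isClosed_iInter fun _ =>
        isClosed_le (by fun_prop) (by fun_prop)
    · exact isClosed_eq (by fun_prop) (by fun_prop)
  · rintro _ ⟨l, rfl, hl, hle⟩ x -
    have h1 := hl _ (hc x)
    have h2 := hl _ (hc (-x))
    simp only [map_sub, map_smul, map_neg, hle, smul_eq_mul, mul_one] at h1 h2
    exact ⟨by linarith, by linarith⟩

lemma state_nonneg_of_extremePoints (C : PointedCone ℝ E) {e : E}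
    (hu : ∀ x, ∃ c : ℝ, c • e - x ∈ C) {y : E}
    (hy : ∀ L ∈ (stateSpace C e).extremePoints ℝ, 0 ≤ L y) :
    ∀ L ∈ stateSpace C e, 0 ≤ L y := by
  have hcl : closure (convexHull ℝ ((stateSpace C e).extremePoints ℝ)) ⊆ {L | 0 ≤ L y} := by
    refine closure_minimal (convexHull_min hy ?_) (isClosed_le (by fun_prop) (by fun_prop))
    exact convex_halfSpace_ge (LinearMap.isLinear (LinearMap.proj (R := ℝ) y)) 0
  rwa [closure_convexHull_extremePoints (isCompact_stateSpace C hu) (convex_stateSpace C e)] at hcl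

lemma eq_mul_of_mem_extremePoints {C : PointedCone ℝ E} {e : E} (he : e ∈ C) {l m : E →ₗ[ℝ] ℝ}
    (hl : ⇑l ∈ (stateSpace C e).extremePoints ℝ) {N : ℝ} (hN : 0 < N)
    (hm : ∀ x ∈ C, 0 ≤ m x) (hml : ∀ x ∈ C, m x ≤ N * l x) (x : E) : m x = m e * l x := by
  obtain ⟨⟨l', hl', hpos, hle⟩, hext⟩ := mem_extremePoints.1 hl
  obtain rfl := DFunLike.coe_injective hl'
  have h0 : 0 ≤ m e := hm e he
  have h1 : m e ≤ N := by simpa [hle] using hml e he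
  have key := (hext (l' + N⁻¹ • (m - m e • l') : E →ₗ[ℝ] ℝ) ⟨_, rfl, ?_, ?_⟩
    (l' - N⁻¹ • (m - m e • l') : E →ₗ[ℝ] ℝ) ⟨_, rfl, ?_, ?_⟩ ?_).1
  · have := congrFun key x
    simp only [LinearMap.add_apply, LinearMap.smul_apply, LinearMap.sub_apply, smul_eq_mul,
      add_eq_left, mul_eq_zero, inv_eq_zero, hN.ne', false_or] at this
    linarith
  · intro z hz
    have := hm z hz
    have := mul_nonneg (sub_nonneg.2 h1) (hpos z hz)
    have : l' z + N⁻¹ * (m z - m e * l' z) = N⁻¹ * (m z + (N - m e) * l' z) := by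
      field_simp
      ring
    simp only [LinearMap.add_apply, LinearMap.smul_apply, LinearMap.sub_apply, smul_eq_mul, this]
    positivity
  · simp [hle]
  · intro z hz
    have := sub_nonneg.2 (hml z hz)
    have := mul_nonneg h0 (hpos z hz)
    have : l' z - N⁻¹ * (m z - m e * l' z) = N⁻¹ * (N * l' z - m z + m e * l' z) := by
      field_simp
      ring
    simp only [LinearMap.smul_apply, LinearMap.sub_apply, smul_eq_mul, this]
    positivity
  · simp [hle]
  · refine ⟨1 / 2, 1 / 2, by norm_num, by norm_num, by norm_num, ?_⟩
    ext z
    simp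
    ring

end OrderUnit

/-- A nonnegative sequence that is convex in the sense of nonnegative second differences for every
dilation, and grows at most like `N ^ k`, satisfies the growth bound at its first step. -/
lemma le_mul_of_dilation_convex {u : ℕ → ℝ} {N K : ℝ} (hN : 0 ≤ N) (h0 : 0 ≤ u 0)
    (hu : ∀ k (r : ℝ), 0 ≤ u (k + 2) - 2 * r * u (k + 1) + r ^ 2 * u k)
    (hK : ∀ k, u k ≤ K * N ^ k) : u 1 ≤ N * u 0 := by
  by_contra! hlt
  obtain ⟨r, hNr, hr⟩ : ∃ r, N < r ∧ r * u 0 ≤ u 1 := by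
    have hp : 0 < u 0 + 1 := by linarith
    refine ⟨N + (u 1 - N * u 0) / (u 0 + 1), ?_, ?_⟩
    · have : 0 < (u 1 - N * u 0) / (u 0 + 1) := div_pos (by linarith) hp
      linarith
    · have : (u 1 - N * u 0) / (u 0 + 1) * u 0 ≤ u 1 - N * u 0 := by
        rw [div_mul_eq_mul_div, div_le_iff₀ hp]
        nlinarith
      linarith
  have hr0 : 0 < r := by linarith
  have h1 : 0 < u 1 := by nlinarith
  have hstep : ∀ k, r * u k ≤ u (k + 1) := by
    intro k
    induction k with
    | zero => exact hr
    | succ k ih =>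
      have := hu k r
      nlinarith
  have hgrow : ∀ k, r ^ k * u 1 ≤ u (k + 1) := by
    intro k
    induction k with
    | zero => simp
    | succ k ih =>
      have := hstep (k + 1)
      have := mul_le_mul_of_nonneg_left ih hr0.le
      rw [pow_succ']
      linarith
  rcases hN.eq_or_lt with rfl | hN
  · have := hK 1
    simp at this
    linarith
  · obtain ⟨k, hk⟩ := pow_unbounded_of_one_lt (K * N / u 1) ((one_lt_div hN).2 hNr)
    rw [div_lt_iff₀ h1, div_pow, div_mul_eq_mul_div, lt_div_iff₀ (pow_pos hN k)] at hk
    have := hgrow k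
    have := hK (k + 1)
    rw [pow_succ'] at this
    linarith

section CommAction

variable {A E : Type*} [CommRing A] [Algebra ℝ A] [AddCommGroup E] [Module ℝ E] [Module A E]
  [IsScalarTower ℝ A E]

lemma apply_sq_smul_le {C : PointedCone ℝ E} {e : E}
    (hu : ∀ x, ∃ c : ℝ, c • e - x ∈ C) (hsq : ∀ (a : A), ∀ x ∈ C, a ^ 2 • x ∈ C)
    {l : E →ₗ[ℝ] ℝ} (hl : ∀ x ∈ C, 0 ≤ l x) (hle : l e = 1) {a : A} {N : ℝ} (hN : 0 ≤ N)
    (ha : N • e - a ^ 2 • e ∈ C) {x : E} (hx : x ∈ C) : l (a ^ 2 • x) ≤ N * l x := by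
  have hpow : ∀ k : ℕ, l ((a ^ k) ^ 2 • e) ≤ N ^ k := by
    intro k
    induction k with
    | zero => simp [hle]
    | succ k ih =>
      have h := hl _ (hsq (a ^ k) _ ha)
      rw [smul_sub, smul_smul, ← mul_pow, ← pow_succ, smul_comm, map_sub, map_smul,
        smul_eq_mul] at h
      have := mul_le_mul_of_nonneg_left ih hN
      rw [pow_succ' N]
      linarith
  obtain ⟨c, hc⟩ := hu x
  have h0 : 0 ≤ c := by
    have h1 := hl _ hc
    have h2 := hl _ hx
    simp only [map_sub, map_smul, hle, smul_eq_mul, mul_one] at h1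
    linarith
  have key := le_mul_of_dilation_convex (u := fun k => l ((a ^ k) ^ 2 • x)) (K := c) hN
    (by simpa using hl x hx) (fun k r => ?_) (fun k => ?_)
  · simpa using key
  · have h := hl _ (hsq (a ^ k * (a ^ 2 - algebraMap ℝ A r)) _ hx)
    have heq : (a ^ k * (a ^ 2 - algebraMap ℝ A r)) ^ 2 = (a ^ (k + 2)) ^ 2
        - (2 * r) • (a ^ (k + 1)) ^ 2 + (r ^ 2) • (a ^ k) ^ 2 := by
      simp only [Algebra.smul_def, map_mul, map_pow, map_ofNat]
      ring
    rw [heq, add_smul, sub_smul, smul_assoc, smul_assoc, map_add, map_sub, l.map_smul,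
      l.map_smul] at h
    simpa only [smul_eq_mul] using h
  · have h := hl _ (hsq (a ^ k) _ hc)
    rw [smul_sub, smul_comm, map_sub, map_smul, smul_eq_mul] at h
    have := mul_le_mul_of_nonneg_left (hpow k) h0
    linarith

lemma extremePoint_apply_smul {C : PointedCone ℝ E} {e : E} (he : e ∈ C)
    (hu : ∀ x, ∃ c : ℝ, c • e - x ∈ C) (hsq : ∀ (a : A), ∀ x ∈ C, a ^ 2 • x ∈ C)
    {l : E →ₗ[ℝ] ℝ} (hl : ⇑l ∈ (stateSpace C e).extremePoints ℝ) (a : A) (x : E) :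
    l (a • x) = l (a • e) * l x := by
  obtain ⟨l', hl', hpos, hle⟩ := hl.1
  obtain rfl := DFunLike.coe_injective hl'
  have hsqr : ∀ (b : A) (z : E), l' (b ^ 2 • z) = l' (b ^ 2 • e) * l' z := by
    intro b z
    obtain ⟨c, hc⟩ := hu (b ^ 2 • e)
    have hN : 0 < |c| + 1 := by positivity
    have hb : (|c| + 1) • e - b ^ 2 • e ∈ C := by
      have := C.add_mem hc (C.smul_mem
        (by linarith [le_abs_self c] : 0 ≤ |c| + 1 - c) he)
      rwa [show c • e - b ^ 2 • e + (|c| + 1 - c) • e = (|c| + 1) • e - b ^ 2 • e by module] at this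
    exact eq_mul_of_mem_extremePoints he (m := l' ∘ₗ Algebra.lsmul ℝ ℝ E (b ^ 2)) hl hN
      (fun w hw => hpos _ (hsq b w hw))
      (fun w hw => apply_sq_smul_le hu hsq hpos hle hN.le hb hw) z
  have hpol : ∀ z : E, l' (a • z) = 4⁻¹ * (l' ((a + 1) ^ 2 • z) - l' ((a - 1) ^ 2 • z)) := by
    intro z
    have : (a + 1) ^ 2 • z - (a - 1) ^ 2 • z = (4 : ℝ) • a • z := by
      rw [← sub_smul, ← smul_assoc, Algebra.smul_def, map_ofNat]
      congr 1
      ring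
    rw [← map_sub, this, l'.map_smul, smul_eq_mul]
    ring
  rw [hpol x, hpol e, hsqr (a + 1) x, hsqr (a - 1) x]
  ring

end CommAction

section QuadraticModule

variable {n t : ℕ} {G : Set (Matrix (Fin t) (Fin t) (MvPolynomial (Fin n) ℝ))}

lemma InQM.zero : InQM n t G 0 :=
  ⟨0, Fin.elim0, Fin.elim0, fun i => i.elim0, by simp⟩

lemma InQM.add {p q : Matrix (Fin t) (Fin t) (MvPolynomial (Fin n) ℝ)} (hp : InQM n t G p)
    (hq : InQM n t G q) : InQM n t G (p + q) := by
  obtain ⟨N, g, a, hg, rfl⟩ := hp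
  obtain ⟨M, h, b, hh, rfl⟩ := hq
  refine ⟨N + M, Fin.append g h, Fin.append a b, ?_, by simp [Fin.sum_univ_add]⟩
  intro i
  refine Fin.addCases (fun i => ?_) (fun i => ?_) i
  · simpa using hg i
  · simpa using hh i

lemma InQM.conj {p : Matrix (Fin t) (Fin t) (MvPolynomial (Fin n) ℝ)} (hp : InQM n t G p)
    (c : Matrix (Fin t) (Fin t) (MvPolynomial (Fin n) ℝ)) : InQM n t G (cᵀ * p * c) := by
  obtain ⟨N, g, a, hg, rfl⟩ := hp
  exact ⟨N, g, fun i => a i * c, hg, by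
    simp [Finset.mul_sum, Finset.sum_mul, Matrix.transpose_mul, Matrix.mul_assoc]⟩

lemma InQM.of_generator {g : Matrix (Fin t) (Fin t) (MvPolynomial (Fin n) ℝ)}
    (hg : g = 1 ∨ g ∈ G) : InQM n t G g :=
  ⟨1, fun _ => g, fun _ => 1, fun _ => hg, by simp⟩

lemma InQM.transpose_mul_self (c : Matrix (Fin t) (Fin t) (MvPolynomial (Fin n) ℝ)) :
    InQM n t G (cᵀ * c) := by
  simpa using (InQM.of_generator (G := G) (Or.inl rfl)).conj c

lemma InQM.sq_smul {p : Matrix (Fin t) (Fin t) (MvPolynomial (Fin n) ℝ)} (hp : InQM n t G p)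
    (a : MvPolynomial (Fin n) ℝ) : InQM n t G (a ^ 2 • p) := by
  simpa [smul_smul, sq] using hp.conj (a • 1)

lemma InQM.real_smul {p : Matrix (Fin t) (Fin t) (MvPolynomial (Fin n) ℝ)} (hp : InQM n t G p)
    {c : ℝ} (hc : 0 ≤ c) : InQM n t G (c • p) := by
  have h := hp.sq_smul (algebraMap ℝ _ (√c))
  rwa [← map_pow, Real.sq_sqrt hc, algebraMap_smul] at h

lemma InQM.transpose_eq (hG : ∀ g ∈ G, gᵀ = g)
    {p : Matrix (Fin t) (Fin t) (MvPolynomial (Fin n) ℝ)} (hp : InQM n t G p) : pᵀ = p := by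
  obtain ⟨N, g, a, hg, rfl⟩ := hp
  have : ∀ i, (g i)ᵀ = g i := fun i => by
    rcases hg i with h | h
    · rw [h, Matrix.transpose_one]
    · exact hG _ h
  simp [Matrix.transpose_sum, Matrix.transpose_mul, Matrix.mul_assoc, this]

lemma InQM.posSemidef_eval {p : Matrix (Fin t) (Fin t) (MvPolynomial (Fin n) ℝ)}
    (hp : InQM n t G p) {x : Fin n → ℝ} (hx : x ∈ SG n t G) :
    (p.map (MvPolynomial.eval x)).PosSemidef := by
  obtain ⟨N, g, a, hg, rfl⟩ := hp
  rw [← RingHom.mapMatrix_apply, map_sum]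
  refine Matrix.posSemidef_sum _ fun i _ => ?_
  have hgi : ((g i).map (MvPolynomial.eval x)).PosSemidef := by
    rcases hg i with h | h
    · rw [h, ← RingHom.mapMatrix_apply, map_one]
      exact Matrix.PosSemidef.one
    · exact hx _ h
  simpa [Matrix.transpose_map] using hgi.conjTranspose_mul_mul_same ((a i).map (MvPolynomial.eval x))

variable (G) in
/-- The cone of matrix polynomials whose symmetrization lies in the quadratic module of `G`. -/
def symmCone : PointedCone ℝ (Matrix (Fin t) (Fin t) (MvPolynomial (Fin n) ℝ)) where
  carrier := {p | InQM n t G (p + pᵀ)}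
  add_mem' {p q} hp hq := by
    have := InQM.add hp hq
    rwa [add_add_add_comm, ← Matrix.transpose_add] at this
  zero_mem' := by simpa using InQM.zero
  smul_mem' := by
    rintro ⟨c, hc⟩ p hp
    have := InQM.real_smul hp hc
    rwa [smul_add, ← Matrix.transpose_smul] at this

lemma mem_symmCone {p : Matrix (Fin t) (Fin t) (MvPolynomial (Fin n) ℝ)} :
    p ∈ symmCone G ↔ InQM n t G (p + pᵀ) := Iff.rfl

lemma mem_symmCone_iff_of_transpose_eq {p : Matrix (Fin t) (Fin t) (MvPolynomial (Fin n) ℝ)}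
    (hp : pᵀ = p) : p ∈ symmCone G ↔ InQM n t G p := by
  rw [mem_symmCone, hp, ← two_smul ℝ]
  refine ⟨fun h => ?_, fun h => h.real_smul zero_le_two⟩
  have := h.real_smul (inv_nonneg.2 zero_le_two)
  rwa [inv_smul_smul₀ two_ne_zero] at this

lemma IsArch.exists_smul_one_sub_mem (harch : IsArch n t G)
    (p : Matrix (Fin t) (Fin t) (MvPolynomial (Fin n) ℝ)) :
    ∃ c : ℝ, c • (1 : Matrix (Fin t) (Fin t) (MvPolynomial (Fin n) ℝ)) - p ∈ symmCone G := by
  obtain ⟨h, hh⟩ : ∃ h, h = p + pᵀ := ⟨_, rfl⟩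
  have hsymm : hᵀ = h := by rw [hh, Matrix.transpose_add, Matrix.transpose_transpose, add_comm]
  obtain ⟨N, hN⟩ := harch h
  refine ⟨(N + 1 / 4) / 2, ?_⟩
  have key := hN.add (InQM.transpose_mul_self (h - (1 / 2 : ℝ) • 1))
  rw [mem_symmCone]
  convert key using 1
  have hcast : (N : Matrix (Fin t) (Fin t) (MvPolynomial (Fin n) ℝ)) = (N : ℝ) • 1 := by
    rw [Nat.cast_smul_eq_nsmul, nsmul_one]
  simp only [Matrix.transpose_sub, Matrix.transpose_smul, Matrix.transpose_one, hsymm, hcast,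
    sub_mul, mul_sub, Matrix.smul_mul, Matrix.mul_smul, one_mul, mul_one]
  rw [show (((N : ℝ) + 1 / 4) / 2) • (1 : Matrix (Fin t) (Fin t) (MvPolynomial (Fin n) ℝ)) - p +
    ((((N : ℝ) + 1 / 4) / 2) • 1 - pᵀ) = ((N : ℝ) + 1 / 4) • 1 - (p + pᵀ) by module, ← hh]
  module

lemma sq_smul_mem_symmCone (a : MvPolynomial (Fin n) ℝ)
    {p : Matrix (Fin t) (Fin t) (MvPolynomial (Fin n) ℝ)} (hp : p ∈ symmCone G) :
    a ^ 2 • p ∈ symmCone G := by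
  have := InQM.sq_smul hp a
  rwa [smul_add, ← Matrix.transpose_smul] at this

lemma one_mem_symmCone : (1 : Matrix (Fin t) (Fin t) (MvPolynomial (Fin n) ℝ)) ∈ symmCone G :=
  (mem_symmCone_iff_of_transpose_eq Matrix.transpose_one).2 (.of_generator (.inl rfl))

end QuadraticModule

section PointEvaluation

variable {n t : ℕ} {l : Matrix (Fin t) (Fin t) (MvPolynomial (Fin n) ℝ) →ₗ[ℝ] ℝ}

lemma apply_smul_eq_eval_of_multiplicative (hle : l 1 = 1)
    (hl : ∀ (a : MvPolynomial (Fin n) ℝ) p, l (a • p) = l (a • 1) * l p)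
    (a : MvPolynomial (Fin n) ℝ) (p : Matrix (Fin t) (Fin t) (MvPolynomial (Fin n) ℝ)) :
    l (a • p) = MvPolynomial.eval (fun i => l (MvPolynomial.X (R := ℝ) i • 1)) a * l p := by
  rw [hl]
  congr 1
  induction a using MvPolynomial.induction_on with
  | C r =>
    rw [← MvPolynomial.algebraMap_eq, algebraMap_smul, l.map_smul, hle,
      MvPolynomial.algebraMap_eq, MvPolynomial.eval_C, smul_eq_mul, mul_one]
  | add a b ha hb => rw [add_smul, map_add, ha, hb, map_add]
  | mul_X a i ha => rw [mul_smul, hl, ha, map_mul, MvPolynomial.eval_X]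

lemma apply_eq_apply_map_eval {x : Fin n → ℝ}
    (hl : ∀ (a : MvPolynomial (Fin n) ℝ) p, l (a • p) = MvPolynomial.eval x a * l p)
    (p : Matrix (Fin t) (Fin t) (MvPolynomial (Fin n) ℝ)) :
    l p = l ((p.map (MvPolynomial.eval x)).map MvPolynomial.C) := by
  have hsum : ∀ q : Matrix (Fin t) (Fin t) (MvPolynomial (Fin n) ℝ),
      l q = ∑ i, ∑ j, MvPolynomial.eval x (q i j) * l (Matrix.single i j 1) := by
    intro q
    conv_lhs => rw [Matrix.matrix_eq_sum_single q]
    simp only [map_sum, ← hl, Matrix.smul_single, smul_eq_mul, mul_one]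
  rw [hsum p, hsum]
  simp

end PointEvaluation

section Extreme

variable {n t : ℕ} {G : Set (Matrix (Fin t) (Fin t) (MvPolynomial (Fin n) ℝ))}
  {l : Matrix (Fin t) (Fin t) (MvPolynomial (Fin n) ℝ) →ₗ[ℝ] ℝ} {x : Fin n → ℝ}

lemma mem_SG_of_apply_smul_eq_eval (hG : ∀ g ∈ G, gᵀ = g) (hpos : ∀ p, InQM n t G p → 0 ≤ l p)
    (hle : l 1 = 1)
    (hl : ∀ (a : MvPolynomial (Fin n) ℝ) p, l (a • p) = MvPolynomial.eval x a * l p) :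
    x ∈ SG n t G := by
  obtain ⟨k, hk⟩ : ∃ k : Fin t, 0 < l (Matrix.single k k 1) := by
    by_contra! h
    have : l 1 = ∑ k : Fin t, l (Matrix.single k k 1) := by
      rw [← map_sum, Matrix.sum_single_one]
    have := Finset.sum_nonpos fun k (_ : k ∈ Finset.univ) => h k
    linarith
  intro g hg
  refine .of_dotProduct_mulVec_nonneg ?_ fun v => ?_
  · rw [Matrix.IsHermitian, Matrix.conjTranspose_eq_transpose_of_trivial, ← Matrix.transpose_map,
      hG g hg]
  · let A : Matrix (Fin t) (Fin t) (MvPolynomial (Fin n) ℝ) :=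
      Matrix.vecMulVec (fun i => MvPolynomial.C (v i)) (Pi.single k 1)
    have hA : Aᵀ * g * A = ((fun i => MvPolynomial.C (v i)) ⬝ᵥ
        g *ᵥ (fun i => MvPolynomial.C (v i))) • Matrix.single k k 1 := by
      rw [Matrix.transpose_vecMulVec, Matrix.mul_assoc, Matrix.mul_vecMulVec,
        Matrix.vecMulVec_mul_vecMulVec, Matrix.single_eq_single_vecMulVec_single,
        Matrix.vecMulVec_smul]
    have h := hpos _ ((InQM.of_generator (.inr hg)).conj A)
    rw [hA, hl] at h
    have h' := nonneg_of_mul_nonneg_left h hk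
    simpa [dotProduct, Matrix.mulVec] using h'

open scoped MatrixOrder in
lemma apply_nonneg_of_posSemidef_eval (hpos : ∀ p, InQM n t G p → 0 ≤ l p)
    (hl : ∀ (a : MvPolynomial (Fin n) ℝ) p, l (a • p) = MvPolynomial.eval x a * l p)
    {f : Matrix (Fin t) (Fin t) (MvPolynomial (Fin n) ℝ)}
    (hf : (f.map (MvPolynomial.eval x)).PosSemidef) : 0 ≤ l f := by
  obtain ⟨B, hB⟩ := CStarAlgebra.nonneg_iff_eq_star_mul_self.mp hf.nonneg
  rw [apply_eq_apply_map_eval hl, hB, Matrix.map_mul, Matrix.star_eq_conjTranspose,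
    Matrix.conjTranspose_eq_transpose_of_trivial, Matrix.transpose_map]
  exact hpos _ (.transpose_mul_self _)

end Extreme

/-- **Corollary 12.** If `M_G` is archimedean, a symmetric matrix polynomial `f` is positive
semidefinite on `S_G` if and only if `f + ε·I ∈ M_G` for every real `ε > 0`. -/
theorem stmt14 (G : Set (Matrix (Fin t) (Fin t) (MvPolynomial (Fin n) ℝ)))
    (hG : ∀ g ∈ G, gᵀ = g) (harch : IsArch n t G)
    (f : Matrix (Fin t) (Fin t) (MvPolynomial (Fin n) ℝ)) (hf : fᵀ = f) :
    (∀ x ∈ SG n t G, (f.map (MvPolynomial.eval x)).PosSemidef) ↔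
      ∀ ε : ℝ, 0 < ε →
        InQM n t G (f + (MvPolynomial.C ε : MvPolynomial (Fin n) ℝ) • (1 : Matrix (Fin t) (Fin t) (MvPolynomial (Fin n) ℝ))) := by
  have hC : ∀ ε : ℝ, (MvPolynomial.C ε : MvPolynomial (Fin n) ℝ) •
      (1 : Matrix (Fin t) (Fin t) (MvPolynomial (Fin n) ℝ)) = ε • 1 := fun ε => by
    rw [← MvPolynomial.algebraMap_eq, algebraMap_smul]
  constructor
  · intro h ε hε
    have hsymm : (f + ε • (1 : Matrix (Fin t) (Fin t) (MvPolynomial (Fin n) ℝ)))ᵀ = f + ε • 1 := by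
      simp [hf]
    rw [hC, ← mem_symmCone_iff_of_transpose_eq hsymm]
    by_contra hmem
    have hu := harch.exists_smul_one_sub_mem
    obtain ⟨l, hl, hle, hlf⟩ := exists_state_nonpos _ one_mem_symmCone hu hmem
    have hf0 : 0 ≤ l f := by
      refine state_nonneg_of_extremePoints _ hu (fun L hL => ?_) l ⟨l, rfl, hl, hle⟩
      obtain ⟨m, rfl, hm, hme⟩ := hL.1
      have hmul := apply_smul_eq_eval_of_multiplicative hme
        (extremePoint_apply_smul one_mem_symmCone hu (fun a _ => sq_smul_mem_symmCone a) hL)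
      have hpos : ∀ p, InQM n t G p → 0 ≤ m p := fun p hp =>
        hm p ((mem_symmCone_iff_of_transpose_eq (hp.transpose_eq hG)).2 hp)
      exact apply_nonneg_of_posSemidef_eval hpos hmul
        (h _ (mem_SG_of_apply_smul_eq_eval hG hpos hme hmul))
    rw [map_add, l.map_smul, hle, smul_eq_mul, mul_one] at hlf
    linarith
  · intro h x hx
    refine .of_dotProduct_mulVec_nonneg ?_ fun v => ?_
    · rw [Matrix.IsHermitian, Matrix.conjTranspose_eq_transpose_of_trivial, ← Matrix.transpose_map,
        hf]
    · have hv : ∀ ε : ℝ, 0 < ε →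
          0 ≤ star v ⬝ᵥ (f.map (MvPolynomial.eval x) *ᵥ v) + ε * (star v ⬝ᵥ v) := by
        intro ε hε
        have h1 := ((h ε hε).posSemidef_eval hx).dotProduct_mulVec_nonneg v
        have h2 : (f + (MvPolynomial.C ε : MvPolynomial (Fin n) ℝ) • 1).map (MvPolynomial.eval x) =
            f.map (MvPolynomial.eval x) + ε • 1 := by
          ext i j
          by_cases hij : i = j <;> simp [hij]
        rwa [h2, Matrix.add_mulVec, dotProduct_add, Matrix.smul_mulVec, Matrix.one_mulVec,
          dotProduct_smul, smul_eq_mul] at h1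
      have hlim : Filter.Tendsto (fun ε : ℝ => star v ⬝ᵥ (f.map (MvPolynomial.eval x) *ᵥ v) +
          ε * (star v ⬝ᵥ v)) (nhdsWithin 0 (Set.Ioi 0))
          (nhds (star v ⬝ᵥ (f.map (MvPolynomial.eval x) *ᵥ v) + 0 * (star v ⬝ᵥ v))) :=
        Filter.Tendsto.mono_left (Continuous.tendsto (by fun_prop) 0) nhdsWithin_le_nhds
      rw [zero_mul, add_zero] at hlim
      exact ge_of_tendsto hlim (Filter.eventually_of_mem self_mem_nhdsWithin hv)
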